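/- For every separable state ρ on C^d ⊗ C^d (d ≥ 2), the entropic entanglement parameter satisfies M(ρ) ≤ 0. -/

import Mathlib

open Matrix Kronecker BigOperators ComplexOrder

noncomputable section

namespace EEP

/-- `-(x * log₂ x)`; note `Real.logb 2 0 = 0`, giving the convention `0·log₂ 0 = 0`. -/
def negMulLog2 (x : ℝ) : ℝ := -(x * Real.logb 2 x)

/-- Shannon entropy (base 2) of a finite family of reals. -/
def shannon {n : Type*} [Fintype n] (p : n → ℝ) : ℝ := ∑ i, negMulLog2 (p i)

/-- A quantum state: positive semidefinite (hence Hermitian) matrix with trace 1. -/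
def IsState {n : Type*} [Fintype n] [DecidableEq n] (ρ : Matrix n n ℂ) : Prop :=
  ρ.PosSemidef ∧ ρ.trace = 1

/-- A rank-one orthogonal projection matrix. -/
def IsRankOneProj {n : Type*} [Fintype n] [DecidableEq n] (P : Matrix n n ℂ) : Prop :=
  P.IsHermitian ∧ P * P = P ∧ P.rank = 1

/-- A von Neumann measurement on `C^d ⊗ C^d`: a family of `d²` rank-one orthogonal
projections, mutually orthogonal, summing to the identity. -/
def IsMeasurement {d : ℕ} (P : Fin (d^2) → Matrix (Fin d × Fin d) (Fin d × Fin d) ℂ) : Prop :=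
  (∀ i, IsRankOneProj (P i)) ∧ (∀ i j, i ≠ j → P i * P j = 0) ∧ (∑ i, P i) = 1

/-- Klein entropy: Shannon entropy of the outcome distribution `pᵢ = Tr(ρ Pᵢ)`. -/
def kleinEntropy {d : ℕ} (ρ : Matrix (Fin d × Fin d) (Fin d × Fin d) ℂ)
    (P : Fin (d^2) → Matrix (Fin d × Fin d) (Fin d × Fin d) ℂ) : ℝ :=
  shannon (fun i => (ρ * P i).trace.re)

/-- A product state: Kronecker product of two states on `C^d`. -/
def IsProductState {d : ℕ} (δ : Matrix (Fin d × Fin d) (Fin d × Fin d) ℂ) : Prop :=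
  ∃ σA σB : Matrix (Fin d) (Fin d) ℂ, IsState σA ∧ IsState σB ∧ δ = σA ⊗ₖ σB

/-- Infimum of the Klein entropy over product states, for a fixed measurement. -/
def infProd {d : ℕ} (P : Fin (d^2) → Matrix (Fin d × Fin d) (Fin d × Fin d) ℂ) : ℝ :=
  sInf {x : ℝ | ∃ δ, IsProductState δ ∧ x = kleinEntropy δ P}

/-- The entropic entanglement parameter
`M(ρ) = sup_P ( inf_{δ product} H(δ,P) − H(ρ,P) )`. -/
def eep {d : ℕ} (ρ : Matrix (Fin d × Fin d) (Fin d × Fin d) ℂ) : ℝ :=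
  sSup {x : ℝ | ∃ P, IsMeasurement P ∧ x = infProd P - kleinEntropy ρ P}

/-- A separable state: finite convex combination of product states. -/
def IsSeparable {d : ℕ} (ρ : Matrix (Fin d × Fin d) (Fin d × Fin d) ℂ) : Prop :=
  ∃ (m : ℕ) (p : Fin m → ℝ) (δ : Fin m → Matrix (Fin d × Fin d) (Fin d × Fin d) ℂ),
    (∀ i, 0 ≤ p i) ∧ (∑ i, p i) = 1 ∧ (∀ i, IsProductState (δ i)) ∧
    ρ = ∑ i, (p i : ℂ) • δ i

/-- Rank-one projection `|v⟩⟨v|` onto a vector `v`. -/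
def projVec {n : Type*} (v : n → ℂ) : Matrix n n ℂ := Matrix.vecMulVec v (star v)

/-- Coefficient matrix `A` of a vector `ψ ∈ C^d ⊗ C^d`, `A i j = ψ (i,j)`. -/
def coeffMat {d : ℕ} (ψ : Fin d × Fin d → ℂ) : Matrix (Fin d) (Fin d) ℂ :=
  Matrix.of fun i j => ψ (i, j)

/-- The squared Schmidt coefficients of `ψ`: the eigenvalues of `A Aᴴ`
where `A` is the coefficient matrix of `ψ`. -/
def schmidtSq {d : ℕ} (ψ : Fin d × Fin d → ℂ) : Fin d → ℝ :=
  (Matrix.isHermitian_mul_conjTranspose_self (coeffMat ψ)).eigenvalues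

/-- Largest squared Schmidt coefficient (square of the largest singular value of `A`). -/
def maxSchmidtSq {d : ℕ} (ψ : Fin d × Fin d → ℂ) : ℝ := ⨆ i, schmidtSq ψ i

/-- A unit vector. -/
def IsUnitVec {n : Type*} [Fintype n] (ψ : n → ℂ) : Prop := (∑ p, Complex.normSq (ψ p)) = 1

/-- A maximally entangled unit vector: all squared Schmidt coefficients equal `1/d`. -/
def IsMaxEntVec {d : ℕ} (ψ : Fin d × Fin d → ℂ) : Prop :=
  IsUnitVec ψ ∧ ∀ i, schmidtSq ψ i = 1 / d

/-- A von Neumann measurement in a maximally entangled basis. -/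
def IsMaxEntMeasurement {d : ℕ}
    (P : Fin (d^2) → Matrix (Fin d × Fin d) (Fin d × Fin d) ℂ) : Prop :=
  IsMeasurement P ∧ ∀ i, ∃ ψ, IsMaxEntVec ψ ∧ P i = projVec ψ

/-- Von Neumann entropy: Shannon entropy of the eigenvalues. -/
def vnEntropy {n : Type*} [Fintype n] [DecidableEq n] {ρ : Matrix n n ℂ}
    (h : ρ.IsHermitian) : ℝ := shannon h.eigenvalues

/-- Binary Shannon entropy. -/
def binEnt (x : ℝ) : ℝ := negMulLog2 x + negMulLog2 (1 - x)

lemma negMulLog2_eq (x : ℝ) : negMulLog2 x = Real.negMulLog x / Real.log 2 := by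
  unfold negMulLog2 Real.negMulLog Real.logb
  ring

lemma concave_nml : ConcaveOn ℝ (Set.Ici (0:ℝ)) negMulLog2 := by
  have h := Real.concaveOn_negMulLog.smul
    (c := (Real.log 2)⁻¹) (inv_nonneg.mpr (Real.log_nonneg (by norm_num)))
  have e : negMulLog2 = fun x => (Real.log 2)⁻¹ • Real.negMulLog x := by
    funext x
    rw [negMulLog2_eq]
    simp [div_eq_inv_mul]
  rw [e]
  exact h

lemma nml_nonneg {x : ℝ} (h0 : 0 ≤ x) (h1 : x ≤ 1) : 0 ≤ negMulLog2 x := by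
  rw [negMulLog2_eq]
  exact div_nonneg (Real.negMulLog_nonneg h0 h1) (Real.log_nonneg (by norm_num))

lemma prod_isState {d : ℕ} {δ : Matrix (Fin d × Fin d) (Fin d × Fin d) ℂ}
    (h : IsProductState δ) : IsState δ := by
  obtain ⟨A, B, hA, hB, rfl⟩ := h
  refine ⟨hA.1.kronecker hB.1, ?_⟩
  rw [Matrix.trace_kronecker, hA.2, hB.2, one_mul]

lemma prob_nonneg {n : Type*} [Fintype n] [DecidableEq n] {δ P : Matrix n n ℂ}
    (h : IsState δ) (hP : IsRankOneProj P) : 0 ≤ (δ * P).trace.re := by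
  have h1 : (δ * P).trace = (Pᴴ * δ * P).trace := by
    rw [hP.1.eq, Matrix.mul_assoc, Matrix.trace_mul_comm P, Matrix.mul_assoc, hP.2.1]
  rw [h1]
  have := (h.1.conjTranspose_mul_mul_same P).trace_nonneg
  exact (Complex.le_def.mp this).1

lemma prob_sum {d : ℕ} {δ : Matrix (Fin d × Fin d) (Fin d × Fin d) ℂ}
    {P : Fin (d^2) → Matrix (Fin d × Fin d) (Fin d × Fin d) ℂ}
    (h : IsState δ) (hP : IsMeasurement P) : ∑ i, (δ * P i).trace.re = 1 := by
  rw [← Complex.re_sum, ← Matrix.trace_sum, ← Matrix.mul_sum, hP.2.2, Matrix.mul_one, h.2]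
  rfl

lemma klein_nonneg {d : ℕ} {δ : Matrix (Fin d × Fin d) (Fin d × Fin d) ℂ}
    {P : Fin (d^2) → Matrix (Fin d × Fin d) (Fin d × Fin d) ℂ}
    (h : IsState δ) (hP : IsMeasurement P) : 0 ≤ kleinEntropy δ P := by
  unfold kleinEntropy shannon
  refine Finset.sum_nonneg fun i _ => nml_nonneg (prob_nonneg h (hP.1 i)) ?_
  rw [← prob_sum h hP]
  exact Finset.single_le_sum (f := fun i => (δ * P i).trace.re)
    (fun j _ => prob_nonneg h (hP.1 j)) (Finset.mem_univ i)

/-- For every separable state ρ on C^d ⊗ C^d (d ≥ 2), M(ρ) ≤ 0. -/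
theorem stmt0 {d : ℕ} (hd : 2 ≤ d) (ρ : Matrix (Fin d × Fin d) (Fin d × Fin d) ℂ)
    (hρ : IsState ρ) (hsep : IsSeparable ρ) : eep ρ ≤ 0 := by
  apply Real.sSup_nonpos
  rintro x ⟨P, hP, rfl⟩
  obtain ⟨m, p, δ, hp, hs, hδ, rfl⟩ := hsep
  have hinf : ∀ k, infProd P ≤ kleinEntropy (δ k) P := fun k => by
    refine csInf_le ⟨0, ?_⟩ ⟨δ k, hδ k, rfl⟩
    rintro y ⟨e, he, rfl⟩
    exact klein_nonneg (prod_isState he) hP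
  have h1 : infProd P ≤ ∑ k, p k * kleinEntropy (δ k) P := by
    calc infProd P = ∑ k, p k * infProd P := by rw [← Finset.sum_mul, hs, one_mul]
      _ ≤ _ := Finset.sum_le_sum fun k _ => mul_le_mul_of_nonneg_left (hinf k) (hp k)
  have h2 : ∑ k, p k * kleinEntropy (δ k) P ≤ kleinEntropy (∑ k, (p k : ℂ) • δ k) P := by
    unfold kleinEntropy shannon
    simp_rw [Finset.mul_sum]
    rw [Finset.sum_comm]
    refine Finset.sum_le_sum fun i _ => ?_
    have h3 := concave_nml.le_map_sum (t := Finset.univ) (w := p)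
      (p := fun k => (δ k * P i).trace.re) (fun k _ => hp k) hs
      (fun k _ => prob_nonneg (prod_isState (hδ k)) (hP.1 i))
    have h4 : ((∑ k, (p k : ℂ) • δ k) * P i).trace.re
        = ∑ k, p k • (δ k * P i).trace.re := by
      rw [Matrix.sum_mul, Matrix.trace_sum, Complex.re_sum]
      refine Finset.sum_congr rfl fun k _ => ?_
      simp [Matrix.trace_smul]
    rw [h4]
    simpa using h3
  linarith

end EEP
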